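/- arXiv:0705.0333 — 2 statements merged into one kernel-verified Lean document; each statement's English description precedes it below -/
import Mathlib

section
/- Let d ≥ 1 and let D ⊆ C^∞(ℝ^m,ℝ) be the real linear subspace of polynomial functions of degree at most d−1. Then for every tuple Y : Fin d → ℝ^m (repetitions allowed), D + m_Y = C^∞(ℝ^m,ℝ) as real vector spaces, where m_Y = ∏_{i} m_{Y(i)} is the product of the ideals m_{Y(i)} = {f | f(Y(i)) = 0}. Equivalently, every smooth f : ℝ^m → ℝ can be written as f = p + g with p a polynomial function of degree at most d−1 and g ∈ m_Y. -/
open scoped Manifold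

/-- `m_y`: the ideal of smooth real-valued functions on `ℝ^m` vanishing at the point `y`. -/
noncomputable def mIdeal {m : ℕ} (y : EuclideanSpace ℝ (Fin m)) :
    Ideal (ContMDiffMap 𝓘(ℝ, EuclideanSpace ℝ (Fin m)) 𝓘(ℝ, ℝ)
      (EuclideanSpace ℝ (Fin m)) ℝ (⊤ : ℕ∞)) where
  carrier := {f | f y = 0}
  add_mem' := by
    intro f g hf hg
    simp only [Set.mem_setOf_eq] at *
    simp [hf, hg]
  zero_mem' := by simp
  smul_mem' := by
    intro c f hf
    simp only [Set.mem_setOf_eq, smul_eq_mul] at *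
    simp [hf]

/-- The real linear subspace of `C^∞(ℝ^m, ℝ)` consisting of polynomial functions of total degree
at most `d - 1`. -/
noncomputable def polySubspace (m d : ℕ) :
    Submodule ℝ (ContMDiffMap 𝓘(ℝ, EuclideanSpace ℝ (Fin m)) 𝓘(ℝ, ℝ)
      (EuclideanSpace ℝ (Fin m)) ℝ (⊤ : ℕ∞)) where
  carrier := {f | ∃ p : MvPolynomial (Fin m) ℝ, p.totalDegree ≤ d - 1
    ∧ ∀ x, f x = MvPolynomial.eval (fun i => x i) p}
  add_mem' := by
    rintro f g ⟨p, hp, hfp⟩ ⟨q, hq, hgq⟩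
    exact ⟨p + q, le_trans (MvPolynomial.totalDegree_add p q) (max_le hp hq),
      fun x => by simp [hfp x, hgq x]⟩
  zero_mem' := ⟨0, by simp, fun x => by simp⟩
  smul_mem' := by
    rintro c f ⟨p, hp, hfp⟩
    exact ⟨c • p, le_trans (MvPolynomial.totalDegree_smul_le c p) hp,
      fun x => by simp [hfp x, MvPolynomial.smul_eval]⟩

open scoped Pointwise

universe u

/-- Parametric integrals over a compact interval of jointly `C^n` functions are `C^n`. -/
theorem contDiff_parametric_intervalIntegral_nat {E : Type u} [NormedAddCommGroup E]
    [NormedSpace ℝ E] [ProperSpace E] (a b : ℝ) (n : ℕ) :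
    ∀ {G : Type u} [NormedAddCommGroup G] [NormedSpace ℝ G] {F : E → ℝ → G},
      ContDiff ℝ n F.uncurry → ContDiff ℝ n fun x => ∫ t in a..b, F x t := by
  induction n with
  | zero =>
    intro G _ _ F hF
    simp only [Nat.cast_zero, contDiff_zero] at hF ⊢
    exact intervalIntegral.continuous_parametric_intervalIntegral_of_continuous' hF a b
  | succ n ih =>
    intro G _ _ F hF
    have hF_diff : Differentiable ℝ F.uncurry := hF.differentiable (by simp)
    have hF_cont := hF.continuous
    let F' : E → ℝ → E →L[ℝ] G := fun x t =>
      (fderiv ℝ F.uncurry (x, t)).comp (ContinuousLinearMap.inl ℝ E ℝ)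
    have hF' : ContDiff ℝ n F'.uncurry :=
      (hF.fderiv_right (m := n) (by simp)).clm_comp contDiff_const
    have hF'_cont : Continuous F'.uncurry := hF'.continuous
    push_cast
    refine contDiff_succ_iff_hasFDerivAt.2 ⟨fun x => ∫ t in a..b, F' x t, ih hF', fun x => ?_⟩
    obtain ⟨M, hM⟩ := ((isCompact_closedBall x 1).prod
      (isCompact_uIcc (a := a) (b := b))).exists_bound_of_continuousOn hF'_cont.continuousOn
    refine intervalIntegral.hasFDerivAt_integral_of_dominated_of_fderiv_le (𝕜 := ℝ) (F' := F')
      (bound := fun _ => M) (Metric.closedBall_mem_nhds x one_pos) (.of_forall fun y => ?_) ?_ ?_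
      (.of_forall fun t ht y hy => hM (y, t) ⟨hy, Set.uIoc_subset_uIcc ht⟩) (by simp)
      (.of_forall fun t _ y _ => ?_)
    · exact (hF_cont.comp (Continuous.prodMk_right y)).aestronglyMeasurable
    · exact (hF_cont.comp (Continuous.prodMk_right x)).intervalIntegrable a b
    · exact (hF'_cont.comp (Continuous.prodMk_right x)).aestronglyMeasurable
    · exact HasFDerivAt.comp (f := fun e => (e, t)) y (hF_diff (y, t)).hasFDerivAt
        (hasFDerivAt_prodMk_left y t)

theorem contDiff_parametric_intervalIntegral {E G : Type u} [NormedAddCommGroup E]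
    [NormedSpace ℝ E] [ProperSpace E] [NormedAddCommGroup G] [NormedSpace ℝ G] (a b : ℝ)
    {F : E → ℝ → G} (hF : ContDiff ℝ (⊤ : ℕ∞) F.uncurry) :
    ContDiff ℝ (⊤ : ℕ∞) fun x => ∫ t in a..b, F x t :=
  contDiff_infty.2 fun n =>
    contDiff_parametric_intervalIntegral_nat a b n (contDiff_infty.1 hF n)

/-- Hadamard's lemma. -/
theorem exists_contDiff_eq_add_sum_mul {m : ℕ} {f : EuclideanSpace ℝ (Fin m) → ℝ}
    (hf : ContDiff ℝ (⊤ : ℕ∞) f) (y : EuclideanSpace ℝ (Fin m)) :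
    ∃ h : Fin m → EuclideanSpace ℝ (Fin m) → ℝ, (∀ j, ContDiff ℝ (⊤ : ℕ∞) (h j)) ∧
      ∀ x, f x = f y + ∑ j, h j x * (x j - y j) := by
  have hf' : ContDiff ℝ (⊤ : ℕ∞) (fderiv ℝ f) := hf.fderiv_right (by simp)
  have hf'_cont := hf'.continuous
  refine ⟨fun j x => ∫ t in (0 : ℝ)..1, fderiv ℝ f (y + t • (x - y)) (EuclideanSpace.single j 1),
    fun j => contDiff_parametric_intervalIntegral 0 1 ?_, fun x => ?_⟩
  · refine ContDiff.clm_apply (hf'.comp ?_) contDiff_const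
    exact contDiff_const.add (contDiff_snd.smul (contDiff_fst.sub contDiff_const))
  · have key : ∫ t in (0 : ℝ)..1, fderiv ℝ f (y + t • (x - y)) (x - y) = f x - f y := by
      have := intervalIntegral.integral_eq_sub_of_hasDerivAt (a := 0) (b := 1)
        (f := fun t : ℝ => f (y + t • (x - y)))
        (f' := fun t => fderiv ℝ f (y + t • (x - y)) (x - y)) (fun t _ => ?_)
        (Continuous.intervalIntegrable (by fun_prop) _ _)
      · simpa using this
      · have hline : HasDerivAt (fun t : ℝ => y + t • (x - y)) (x - y) t := by
          simpa using ((hasDerivAt_id t).smul_const (x - y)).const_add y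
        exact ((hf.differentiable (by simp)) _).hasFDerivAt.comp_hasDerivAt t hline
    have hsum : ∀ t : ℝ, fderiv ℝ f (y + t • (x - y)) (x - y) =
        ∑ j, fderiv ℝ f (y + t • (x - y)) (EuclideanSpace.single j 1) * (x j - y j) := fun t => by
      conv_lhs =>
        enter [2]
        rw [← (EuclideanSpace.basisFun (Fin m) ℝ).sum_repr (x - y)]
      simp only [map_sum, map_smul, EuclideanSpace.basisFun_apply, EuclideanSpace.basisFun_repr,
        PiLp.sub_apply, smul_eq_mul, mul_comm]
    simp_rw [hsum] at key
    rw [intervalIntegral.integral_finsetSum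
      fun j _ => Continuous.intervalIntegrable (by fun_prop) _ _] at key
    simp_rw [intervalIntegral.integral_mul_const] at key
    linarith

section SmoothFunctions

variable {m : ℕ}

/-- The ring `C^∞(ℝ^m, ℝ)`. -/
abbrev SmoothMap (m : ℕ) := ContMDiffMap 𝓘(ℝ, EuclideanSpace ℝ (Fin m)) 𝓘(ℝ, ℝ)
  (EuclideanSpace ℝ (Fin m)) ℝ (⊤ : ℕ∞)

@[simp]
theorem mem_mIdeal {y : EuclideanSpace ℝ (Fin m)} {f : SmoothMap m} : f ∈ mIdeal y ↔ f y = 0 :=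
  Iff.rfl

theorem polySubspace_mono {d e : ℕ} (h : d ≤ e) : polySubspace m d ≤ polySubspace m e := by
  rintro f ⟨p, hp, hf⟩
  exact ⟨p, by omega, hf⟩

theorem mul_mem_polySubspace {d e : ℕ} {f g : SmoothMap m} (hf : f ∈ polySubspace m (d + 1))
    (hg : g ∈ polySubspace m (e + 1)) : f * g ∈ polySubspace m (d + e + 1) := by
  obtain ⟨p, hp, hfp⟩ := hf
  obtain ⟨q, hq, hgq⟩ := hg
  exact ⟨p * q, (MvPolynomial.totalDegree_mul p q).trans (by omega),
    fun x => by simp [hfp x, hgq x]⟩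

/-- By Hadamard's lemma, `m_y` is generated by affine functions. -/
theorem exists_mIdeal_eq_span (y : EuclideanSpace ℝ (Fin m)) :
    ∃ S : Set (SmoothMap m), S ⊆ polySubspace m 2 ∧ mIdeal y = Ideal.span S := by
  let c : Fin m → SmoothMap m := fun j => ⟨fun x => x j - y j,
    ContDiff.contMDiff (by fun_prop)⟩
  refine ⟨Set.range c, ?_, le_antisymm (fun f hf => ?_) (Ideal.span_le.2 ?_)⟩
  · rintro _ ⟨j, rfl⟩
    refine ⟨MvPolynomial.X j - MvPolynomial.C (y j), ?_, fun x => by simp [c]⟩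
    exact (MvPolynomial.totalDegree_sub_C_le _ _).trans (by simp)
  · obtain ⟨h, hh, hfh⟩ := exists_contDiff_eq_add_sum_mul f.contMDiff.contDiff y
    let H : Fin m → SmoothMap m := fun j => ⟨h j, (hh j).contMDiff⟩
    have hf_eq : f = ∑ j, H j * c j := by
      ext x
      rw [hfh x, mem_mIdeal.1 hf, zero_add]
      exact (map_sum (ContMDiffMap.evalRingHom x) (fun j => H j * c j) Finset.univ).symm
    rw [hf_eq]
    exact Ideal.sum_mem _ fun j _ => Ideal.mul_mem_left _ _ (Ideal.subset_span ⟨j, rfl⟩)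
  · rintro _ ⟨j, rfl⟩
    exact sub_self (y j)

theorem exists_prod_mIdeal_eq_span {d : ℕ} (Y : Fin d → EuclideanSpace ℝ (Fin m)) :
    ∃ S : Set (SmoothMap m), S ⊆ polySubspace m (d + 1) ∧ ∏ i, mIdeal (Y i) = Ideal.span S := by
  induction d with
  | zero =>
    refine ⟨{1}, Set.singleton_subset_iff.2 ⟨1, by simp, fun x => by simp⟩, ?_⟩
    simp
  | succ d ih =>
    obtain ⟨S, hS, hS_span⟩ := ih (fun i => Y i.castSucc)
    obtain ⟨T, hT, hT_span⟩ := exists_mIdeal_eq_span (Y (Fin.last d))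
    refine ⟨S * T, Set.mul_subset_iff.2 fun f hf g hg => mul_mem_polySubspace (hS hf) (hT hg), ?_⟩
    rw [Fin.prod_univ_castSucc, hS_span, hT_span, Ideal.span_mul_span]

/-- If an ideal `I` is generated by elements of a real subspace `D`, then every element of `I` is
congruent to an element of `D` modulo `I * m_y`. -/
theorem span_le_sup_mul_mIdeal {D : Submodule ℝ (SmoothMap m)} {S : Set (SmoothMap m)}
    (hS : S ⊆ D) (y : EuclideanSpace ℝ (Fin m)) :
    (Ideal.span S).restrictScalars ℝ ≤ D ⊔ (Ideal.span S * mIdeal y).restrictScalars ℝ := by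
  intro f hf
  rw [Submodule.restrictScalars_mem] at hf
  induction hf using Submodule.span_induction with
  | mem f hf => exact Submodule.mem_sup_left (hS hf)
  | zero => exact zero_mem _
  | add f g _ _ hf hg => exact add_mem hf hg
  | smul h f hf_span hf =>
    have h_sub : h - algebraMap ℝ (SmoothMap m) (h y) ∈ mIdeal y := sub_self (h y)
    have h_eq : h • f = h y • f + f * (h - algebraMap ℝ (SmoothMap m) (h y)) := by
      rw [Algebra.smul_def (h y), smul_eq_mul]
      ring
    rw [h_eq]
    exact add_mem (Submodule.smul_mem _ _ hf)
      (Submodule.mem_sup_right (Ideal.mul_mem_mul hf_span h_sub))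

end SmoothFunctions

/-- For `d ≥ 1`, the space `D` of polynomial functions of degree at most `d − 1` satisfies
`D + m_Y = C^∞(ℝ^m, ℝ)` as real vector spaces for every tuple `Y` of `d` points of `ℝ^m`
(with multiplicities), where `m_Y = ∏ i, m_{Y i}`. -/
theorem polySubspace_sup_prod_mIdeal_eq_top (m d : ℕ) (hd : 1 ≤ d)
    (Y : Fin d → EuclideanSpace ℝ (Fin m)) :
    polySubspace m d ⊔ Submodule.restrictScalars ℝ
      ((∏ i, mIdeal (Y i) : Ideal (ContMDiffMap 𝓘(ℝ, EuclideanSpace ℝ (Fin m)) 𝓘(ℝ, ℝ)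
        (EuclideanSpace ℝ (Fin m)) ℝ (⊤ : ℕ∞))) :
        Submodule (ContMDiffMap 𝓘(ℝ, EuclideanSpace ℝ (Fin m)) 𝓘(ℝ, ℝ)
          (EuclideanSpace ℝ (Fin m)) ℝ (⊤ : ℕ∞)) (ContMDiffMap 𝓘(ℝ, EuclideanSpace ℝ (Fin m)) 𝓘(ℝ, ℝ)
          (EuclideanSpace ℝ (Fin m)) ℝ (⊤ : ℕ∞))) = ⊤ := by
  clear hd
  induction d with
  | zero => simp
  | succ d ih =>
    obtain ⟨S, hS, hS_span⟩ := exists_prod_mIdeal_eq_span (fun i => Y i.castSucc)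
    rw [eq_top_iff, ← ih (fun i => Y i.castSucc), Fin.prod_univ_castSucc, hS_span]
    exact sup_le ((polySubspace_mono d.le_succ).trans le_sup_left) (span_le_sup_mul_mIdeal hS _)
end

section
/- Let E be a finite-dimensional real normed vector space, f : ℝ^m → E a smooth function, r ≥ 0, and x_0, …, x_r ∈ ℝ^m. Then f(x_r) = Σ_{i=0}^{r} i!·∫_{T_i} D^i f(σ_i(t))(x_r − x_0, …, x_r − x_{i−1}) dt · (1/i!), i.e. f(x_r) = Σ_{i=0}^{r} ∫_{T_i} D^i f(σ_i(t))(x_r − x_0, …, x_r − x_{i−1}) dt, where D^i f denotes the i-th iterated Fréchet derivative of f and σ_i : T_i → ℝ^m is σ_i(t) = x_0 + Σ_{l=1}^{i} t_l(x_l − x_0) (for i = 0 the term is f(x_0)). -/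
open MeasureTheory

/-- The standard `i`-simplex `T_i = {t ∈ ℝ^i | t_l ≥ 0, ∑ t_l ≤ 1}` (of Lebesgue volume `1/i!`). -/
def simplexSet (i : ℕ) : Set (Fin i → ℝ) :=
  {t | (∀ l, 0 ≤ t l) ∧ ∑ l, t l ≤ 1}

/-- The affine parametrization `[x_0, …, x_k] : T_k → ℝ^m`,
`t ↦ x_0 + ∑_{l=1}^k t_l (x_l − x_0)`, of the simplex with vertices `x_0, …, x_k`. -/
def simplexMap {F : Type*} [AddCommGroup F] [Module ℝ F] {k : ℕ} (x : Fin (k + 1) → F)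
    (t : Fin k → ℝ) : F :=
  x 0 + ∑ l : Fin k, t l • (x l.succ - x 0)

section IteratedDerivatives

variable {V E : Type*} [NormedAddCommGroup V] [NormedSpace ℝ V] [NormedAddCommGroup E]
  [NormedSpace ℝ E]

theorem contDiff_iteratedFDeriv_apply {f : V → E} (hf : ContDiff ℝ (⊤ : ℕ∞) f) {n : ℕ}
    (v : Fin n → V) : ContDiff ℝ (⊤ : ℕ∞) (fun z => iteratedFDeriv ℝ n f z v) :=
  (ContinuousMultilinearMap.apply ℝ (fun _ : Fin n => V) E v).contDiff.comp
    (hf.iteratedFDeriv_right (by exact_mod_cast le_top))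

theorem fderiv_iteratedFDeriv_apply {f : V → E} (hf : ContDiff ℝ (⊤ : ℕ∞) f) {n : ℕ}
    (v : Fin n → V) (z w : V) :
    fderiv ℝ (fun y => iteratedFDeriv ℝ n f y v) z w
      = iteratedFDeriv ℝ (n + 1) f z (Fin.cons w v : Fin (n + 1) → V) := by
  have h : DifferentiableAt ℝ (iteratedFDeriv ℝ n f) z :=
    (hf.differentiable_iteratedFDeriv (by exact_mod_cast WithTop.coe_lt_top n)).differentiableAt
  rw [h.iteratedFDeriv_succ_apply_left', Fin.cons_zero, Fin.tail_cons]

theorem fderiv_apply_comm {g : V → E} (hg : ContDiff ℝ (⊤ : ℕ∞) g) (z a b : V) :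
    fderiv ℝ (fun y => fderiv ℝ g y a) z b = fderiv ℝ (fun y => fderiv ℝ g y b) z a := by
  have hd : DifferentiableAt ℝ (fderiv ℝ g) z :=
    ((hg.fderiv_right (m := 1) (by norm_cast)).differentiable (by simp)).differentiableAt
  have hs : IsSymmSndFDerivAt ℝ g z :=
    hg.contDiffAt.isSymmSndFDerivAt (by simp; norm_cast)
  have key (c d : V) :
      fderiv ℝ (fun y => fderiv ℝ g y c) z d = fderiv ℝ (fderiv ℝ g) z d c := by
    rw [fderiv_clm_apply hd (differentiableAt_const c)]
    simp
  rw [key, key, hs.eq]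

theorem fderiv_iteratedFDeriv_apply_comm (n : ℕ) {f : V → E} (hf : ContDiff ℝ (⊤ : ℕ∞) f)
    (v : Fin n → V) (z w : V) :
    fderiv ℝ (fun y => iteratedFDeriv ℝ n f y v) z w
      = iteratedFDeriv ℝ n (fun y => fderiv ℝ f y w) z v := by
  have hfw : ContDiff ℝ (⊤ : ℕ∞) (fun y => fderiv ℝ f y w) :=
    (hf.fderiv_right (by simp)).clm_apply contDiff_const
  induction n generalizing z w with
  | zero => simp
  | succ n ih =>
    rw [← Fin.cons_self_tail v, ← fderiv_iteratedFDeriv_apply hfw]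
    simp_rw [← fderiv_iteratedFDeriv_apply hf, ← ih (Fin.tail v) _ w hfw]
    exact fderiv_apply_comm (contDiff_iteratedFDeriv_apply hf _) z _ w

theorem fderiv_iteratedFDeriv_apply_eq_snoc {f : V → E} (hf : ContDiff ℝ (⊤ : ℕ∞) f) {n : ℕ}
    (v : Fin n → V) (z w : V) :
    fderiv ℝ (fun y => iteratedFDeriv ℝ n f y v) z w
      = iteratedFDeriv ℝ (n + 1) f z (Fin.snoc v w : Fin (n + 1) → V) := by
  rw [fderiv_iteratedFDeriv_apply_comm n hf, iteratedFDeriv_succ_apply_right, Fin.init_snoc,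
    Fin.snoc_last]
  have h := (ContinuousLinearMap.apply ℝ E w).iteratedFDeriv_comp_left (f := fderiv ℝ f) (x := z)
    (n := (⊤ : ℕ∞)) (hf.fderiv_right (by simp)).contDiffAt (i := n) (by exact_mod_cast le_top)
  exact congrArg (fun m => m v) h

end IteratedDerivatives

section Simplex

theorem isCompact_simplexSet (n : ℕ) : IsCompact (simplexSet n) := by
  refine (isCompact_Icc (a := (0 : Fin n → ℝ)) (b := 1)).of_isClosed_subset ?_ ?_
  · exact (isClosed_le continuous_const continuous_id).inter (isClosed_le
      (continuous_finsetSum _ fun l _ => continuous_apply l) continuous_const)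
  · rintro t ⟨h0, h1⟩
    exact ⟨h0, fun l => (Finset.single_le_sum (fun i _ => h0 i) (Finset.mem_univ l)).trans h1⟩

theorem measurableSet_simplexSet (n : ℕ) : MeasurableSet (simplexSet n) :=
  (isCompact_simplexSet n).isClosed.measurableSet

theorem snoc_sub_single_mem_simplexSet {n : ℕ} (t : Fin (n + 1) → ℝ) (u : ℝ) :
    (Fin.snoc (t - Pi.single (Fin.last n) u) u : Fin (n + 2) → ℝ) ∈ simplexSet (n + 2) ↔
      t ∈ simplexSet (n + 1) ∧ u ∈ Set.Icc 0 (t (Fin.last n)) := by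
  simp only [simplexSet, Set.mem_ofPred_eq, Fin.forall_fin_succ', Fin.sum_univ_castSucc,
    Fin.snoc_castSucc, Fin.snoc_last, Pi.sub_apply, Pi.single_eq_same, Set.mem_Icc,
    Pi.single_eq_of_ne (Fin.castSucc_ne_last _), sub_zero]
  constructor
  · rintro ⟨⟨⟨h1, h2⟩, h3⟩, h4⟩
    exact ⟨⟨⟨h1, by linarith⟩, by linarith⟩, h3, by linarith⟩
  · rintro ⟨⟨⟨h1, h2⟩, h3⟩, h4, h5⟩
    exact ⟨⟨⟨h1, by linarith⟩, h4⟩, by linarith⟩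

variable {V E : Type*} [NormedAddCommGroup V] [NormedSpace ℝ V] [NormedAddCommGroup E]
  [NormedSpace ℝ E]

theorem setIntegral_simplexSet_eq_iterated {n : ℕ} {φ : (Fin (n + 2) → ℝ) → E}
    (hφ : Continuous φ) :
    ∫ t in simplexSet (n + 2), φ t = ∫ t in simplexSet (n + 1),
      ∫ u in (0 : ℝ)..t (Fin.last n),
        φ (Fin.snoc (t - Pi.single (Fin.last n) u) u : Fin (n + 2) → ℝ) := by
  set e := MeasurableEquiv.piFinSuccAbove (fun _ : Fin (n + 2) => ℝ) (Fin.last (n + 1)) with he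
  have hmp : MeasurePreserving e.symm :=
    (volume_preserving_piFinSuccAbove (fun _ : Fin (n + 2) => ℝ) (Fin.last (n + 1))).symm _
  have hes (u : ℝ) (t : Fin (n + 1) → ℝ) :
      e.symm (u, t) = (Fin.snoc t u : Fin (n + 2) → ℝ) := by
    simp [he, MeasurableEquiv.piFinSuccAbove, Fin.insertNthEquiv]
  have hint : Integrable ((simplexSet (n + 2)).indicator φ) :=
    (integrable_indicator_iff (measurableSet_simplexSet _)).2
      (hφ.continuousOn.integrableOn_compact (isCompact_simplexSet _))
  let ψ : ℝ → (Fin (n + 1) → ℝ) → E := fun u t =>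
    φ (Fin.snoc (t - Pi.single (Fin.last n) u) u : Fin (n + 2) → ℝ)
  have hsnoc : Continuous fun p : ℝ × (Fin (n + 1) → ℝ) =>
      (Fin.snoc (p.2 - Pi.single (Fin.last n) p.1) p.1 : Fin (n + 2) → ℝ) := by
    refine continuous_pi fun i => ?_
    refine Fin.lastCases ?_ (fun j => ?_) i
    · simpa using continuous_fst
    · simp only [Fin.snoc_castSucc, Pi.sub_apply]
      refine ((continuous_apply j).comp continuous_snd).sub ?_
      exact (continuous_apply j).comp ((continuous_single (Fin.last n)).comp continuous_fst)
  let S : Set (ℝ × (Fin (n + 1) → ℝ)) :=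
    {p | p.2 ∈ simplexSet (n + 1) ∧ p.1 ∈ Set.Icc 0 (p.2 (Fin.last n))}
  have hSpre : S = (fun p : ℝ × (Fin (n + 1) → ℝ) =>
      (Fin.snoc (p.2 - Pi.single (Fin.last n) p.1) p.1 : Fin (n + 2) → ℝ)) ⁻¹'
        simplexSet (n + 2) := by
    ext p
    exact (snoc_sub_single_mem_simplexSet p.2 p.1).symm
  have hSclosed : IsClosed S := hSpre ▸ (isCompact_simplexSet _).isClosed.preimage hsnoc
  have hScompact : IsCompact S := by
    refine ((isCompact_Icc (a := (0 : ℝ)) (b := 1)).prod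
      (isCompact_simplexSet (n + 1))).of_isClosed_subset hSclosed ?_
    rintro ⟨u, t⟩ ⟨ht, hu⟩
    exact ⟨⟨hu.1, hu.2.trans ((Finset.single_le_sum (fun i _ => ht.1 i)
      (Finset.mem_univ _)).trans ht.2)⟩, ht⟩
  have hψ : Integrable (Function.uncurry fun u t => S.indicator (Function.uncurry ψ) (u, t))
      ((volume : Measure ℝ).prod (volume : Measure (Fin (n + 1) → ℝ))) :=
    (integrable_indicator_iff hSclosed.measurableSet).2
      ((hφ.comp hsnoc).continuousOn.integrableOn_compact hScompact)
  calc ∫ t in simplexSet (n + 2), φ t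
      = ∫ t, (simplexSet (n + 2)).indicator φ t :=
        (integral_indicator (measurableSet_simplexSet _)).symm
    _ = ∫ p : ℝ × (Fin (n + 1) → ℝ), (simplexSet (n + 2)).indicator φ (e.symm p) :=
        (hmp.integral_comp' (f := e.symm) _).symm
    _ = ∫ u : ℝ, ∫ t : Fin (n + 1) → ℝ, (simplexSet (n + 2)).indicator φ (e.symm (u, t)) :=
        integral_prod _ ((hmp.integrable_comp_emb e.symm.measurableEmbedding).2 hint)
    _ = ∫ u : ℝ, ∫ t : Fin (n + 1) → ℝ, S.indicator (Function.uncurry ψ) (u, t) := by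
        refine integral_congr_ae (ae_of_all _ fun u => ?_)
        simp only
        rw [← integral_sub_right_eq_self _ (Pi.single (Fin.last n) u)]
        refine integral_congr_ae (ae_of_all _ fun t => ?_)
        simp only [hes, hSpre]
        rfl
    _ = ∫ t : Fin (n + 1) → ℝ, ∫ u : ℝ, S.indicator (Function.uncurry ψ) (u, t) :=
        integral_integral_swap hψ
    _ = ∫ t, (simplexSet (n + 1)).indicator
          (fun t => ∫ u in (0 : ℝ)..t (Fin.last n), ψ u t) t := by
        refine integral_congr_ae (ae_of_all _ fun t => ?_)
        by_cases ht : t ∈ simplexSet (n + 1)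
        · simp only [Set.indicator_of_mem ht]
          rw [intervalIntegral.integral_of_le (ht.1 _), ← integral_Icc_eq_integral_Ioc,
            ← integral_indicator measurableSet_Icc]
          refine integral_congr_ae (ae_of_all _ fun u => ?_)
          simp [Set.indicator, S, ht, Function.uncurry]
        · simp [Set.indicator, S, ht]
    _ = _ := integral_indicator (measurableSet_simplexSet _)

theorem continuous_simplexMap {n : ℕ} (x : Fin (n + 1) → V) : Continuous (simplexMap x) := by
  unfold simplexMap
  fun_prop

theorem simplexMap_update_last {n : ℕ} (x : Fin (n + 2) → V) (p : V) (t : Fin (n + 1) → ℝ) :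
    simplexMap (Function.update x (Fin.last (n + 1)) p) t
      = simplexMap x t + t (Fin.last n) • (p - x (Fin.last (n + 1))) := by
  have h0 : (0 : Fin (n + 2)) ≠ Fin.last (n + 1) := (Fin.last_pos).ne
  have h (i : Fin n) : (i.castSucc).succ ≠ Fin.last (n + 1) := by
    rw [Fin.succ_castSucc]
    exact Fin.castSucc_ne_last _
  simp only [simplexMap, Fin.sum_univ_castSucc, Fin.succ_last, Function.update_self,
    Function.update_of_ne h0, Function.update_of_ne (h _)]
  module

theorem simplexMap_snoc {n : ℕ} (x : Fin (n + 1) → V) (p : V) (t : Fin n → ℝ) (u : ℝ) :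
    simplexMap (Fin.snoc x p : Fin (n + 2) → V) (Fin.snoc t u : Fin (n + 1) → ℝ)
      = simplexMap x t + u • (p - x 0) := by
  have h0 : (Fin.snoc x p : Fin (n + 2) → V) 0 = x 0 := by
    rw [← Fin.castSucc_zero, Fin.snoc_castSucc]
  simp only [simplexMap, Fin.sum_univ_castSucc, Fin.snoc_castSucc, Fin.snoc_last, h0,
    Fin.succ_castSucc, Fin.succ_last, add_assoc]

theorem simplexMap_sub_single_last {n : ℕ} (x : Fin (n + 2) → V) (t : Fin (n + 1) → ℝ) (u : ℝ) :
    simplexMap x (t - Pi.single (Fin.last n) u)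
      = simplexMap x t - u • (x (Fin.last (n + 1)) - x 0) := by
  simp only [simplexMap, Fin.sum_univ_castSucc, Pi.sub_apply, Pi.single_eq_same,
    Pi.single_eq_of_ne (Fin.castSucc_ne_last _), sub_zero, Fin.succ_last]
  module

theorem setIntegral_simplexSet_one (φ : (Fin 1 → ℝ) → E) :
    ∫ t in simplexSet 1, φ t = ∫ u in (0 : ℝ)..1, φ (fun _ => u) := by
  have hmp : MeasurePreserving (MeasurableEquiv.funUnique (Fin 1) ℝ).symm volume volume := by
    convert (volume_preserving_funUnique (Fin 1) ℝ).symm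
  rw [← hmp.setIntegral_preimage_emb (MeasurableEquiv.measurableEmbedding _) φ,
    intervalIntegral.integral_of_le zero_le_one, ← integral_Icc_eq_integral_Ioc]
  have : (MeasurableEquiv.funUnique (Fin 1) ℝ).symm ⁻¹' simplexSet 1 = Set.Icc 0 1 := by
    ext u
    simp [simplexSet, MeasurableEquiv.funUnique]
  rw [this]
  rfl

variable [CompleteSpace E]

theorem integral_fderiv_segment {h : V → E} (hh : ContDiff ℝ 1 h) (a v : V) (c : ℝ) :
    ∫ u in (0 : ℝ)..c, fderiv ℝ h (a + u • v) v = h (a + c • v) - h a := by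
  have hd (u : ℝ) : HasDerivAt (fun u : ℝ => h (a + u • v)) (fderiv ℝ h (a + u • v) v) u := by
    have h1 : HasDerivAt (fun u : ℝ => a + u • v) v u := by
      simpa using ((hasDerivAt_id u).smul_const v).const_add a
    exact ((hh.differentiable (by simp)) _).hasFDerivAt.comp_hasDerivAt u h1
  have hc : Continuous fun u : ℝ => fderiv ℝ h (a + u • v) v :=
    ((hh.continuous_fderiv (by simp)).comp (by fun_prop)).clm_apply continuous_const
  rw [intervalIntegral.integral_eq_sub_of_hasDerivAt (fun u _ => hd u)
    (hc.intervalIntegrable _ _)]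
  simp

theorem setIntegral_simplexSet_zero (φ : (Fin 0 → ℝ) → E) :
    ∫ t in simplexSet 0, φ t = φ 0 := by
  have : simplexSet 0 = Set.univ := by
    ext t
    simp [simplexSet]
  rw [this, setIntegral_univ, volume_pi, Measure.pi_of_empty _ 0, integral_dirac]

theorem setIntegral_fderiv_simplexMap_snoc {h : V → E} (hh : ContDiff ℝ 1 h) {n : ℕ}
    (x : Fin (n + 1) → V) (p : V) :
    ∫ t in simplexSet (n + 1),
        fderiv ℝ h (simplexMap (Fin.snoc x p : Fin (n + 2) → V) t) (p - x (Fin.last n))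
      = (∫ t in simplexSet n, h (simplexMap (Function.update x (Fin.last n) p) t))
        - ∫ t in simplexSet n, h (simplexMap x t) := by
  cases n with
  | zero =>
    rw [setIntegral_simplexSet_zero, setIntegral_simplexSet_one, setIntegral_simplexSet_zero]
    have hs (u : ℝ) : simplexMap (Fin.snoc x p : Fin 2 → V) (fun _ => u)
        = x 0 + u • (p - x 0) := by
      simp [simplexMap, Fin.snoc]
    simp only [hs]
    have h1 := integral_fderiv_segment hh (x 0) (p - x 0) 1
    simpa [simplexMap] using h1
  | succ n =>
    have hφ : Continuous fun t => fderiv ℝ h (simplexMap (Fin.snoc x p : Fin (n + 3) → V) t)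
        (p - x (Fin.last (n + 1))) :=
      ((hh.continuous_fderiv (by simp)).comp (continuous_simplexMap _)).clm_apply
        continuous_const
    have hint (y : Fin (n + 2) → V) :
        IntegrableOn (fun t => h (simplexMap y t)) (simplexSet (n + 1)) :=
      (hh.continuous.comp (continuous_simplexMap y)).continuousOn.integrableOn_compact
        (isCompact_simplexSet _)
    rw [setIntegral_simplexSet_eq_iterated hφ, ← integral_sub (hint _) (hint _)]
    refine integral_congr_ae (ae_of_all _ fun t => ?_)
    have hs (u : ℝ) : simplexMap (Fin.snoc x p : Fin (n + 3) → V)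
        (Fin.snoc (t - Pi.single (Fin.last n) u) u : Fin (n + 2) → ℝ)
          = simplexMap x t + u • (p - x (Fin.last (n + 1))) := by
      rw [simplexMap_snoc, simplexMap_sub_single_last]
      module
    simp only [hs, simplexMap_update_last]
    exact integral_fderiv_segment hh _ _ _

/-- Newton interpolation at `x 0, …, x (j - 1)` with the remainder in integral form. -/
theorem eq_sum_setIntegral_simplexMap_add_remainder {f : V → E} (hf : ContDiff ℝ (⊤ : ℕ∞) f)
    (x : ℕ → V) (p : V) (j : ℕ) :
    f p = (∑ i ∈ Finset.range j, ∫ t in simplexSet i,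
        iteratedFDeriv ℝ i f (simplexMap (fun l : Fin (i + 1) => x l) t) (fun l => p - x l))
      + ∫ t in simplexSet j, iteratedFDeriv ℝ j f
          (simplexMap (Function.update (fun l : Fin (j + 1) => x l) (Fin.last j) p) t)
          (fun l => p - x l) := by
  induction j with
  | zero =>
    rw [setIntegral_simplexSet_zero]
    simp [simplexMap]
  | succ j ih =>
    rw [ih, Finset.sum_range_succ, add_assoc]
    congr 1
    have hh := (contDiff_iteratedFDeriv_apply hf (fun l : Fin j => p - x l)).of_le
      (m := 1) (by norm_cast)
    have hstep := setIntegral_fderiv_simplexMap_snoc hh (fun l : Fin (j + 1) => x l) p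
    have hx : (Fin.snoc (fun l : Fin (j + 1) => x l) p : Fin (j + 2) → V)
        = Function.update (fun l : Fin (j + 2) => x l) (Fin.last (j + 1)) p := by
      rw [← Fin.snoc_init_self (fun l : Fin (j + 2) => x l), Fin.update_snoc_last]
      rfl
    have hv : (Fin.snoc (fun l : Fin j => p - x l) (p - x j) : Fin (j + 1) → V)
        = fun l : Fin (j + 1) => p - x l :=
      Fin.snoc_init_self (fun l : Fin (j + 1) => p - x l)
    simp only [fderiv_iteratedFDeriv_apply_eq_snoc hf, Fin.val_last, hv, hx] at hstep
    rw [hstep]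
    abel

end Simplex

/-- Glaeser's form of the Taylor expansion: for a smooth `f : ℝ^m → E` and points
`x_0, …, x_r`, `f(x_r) = ∑_{i=0}^{r} ∫_{T_i} D^i f(σ_i(t))(x_r − x_0, …, x_r − x_{i−1}) dt`,
where `σ_i` parametrizes the simplex with vertices `x_0, …, x_i`. -/
theorem taylor_expansion_simplex_integrals {m : ℕ} {E : Type*} [NormedAddCommGroup E]
    [NormedSpace ℝ E] [FiniteDimensional ℝ E]
    (f : EuclideanSpace ℝ (Fin m) → E) (hf : ContDiff ℝ (⊤ : ℕ∞) f)
    (r : ℕ) (x : Fin (r + 1) → EuclideanSpace ℝ (Fin m)) :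
    f (x (Fin.last r)) = ∑ i : Fin (r + 1),
      ∫ t in simplexSet (i : ℕ),
        iteratedFDeriv ℝ (i : ℕ) f (simplexMap (x ∘ Fin.castLE i.isLt) t)
          (fun l : Fin (i : ℕ) => x (Fin.last r) - x (Fin.castLE (le_of_lt i.isLt) l)) := by
  let y : ℕ → EuclideanSpace ℝ (Fin m) := fun n => x (Fin.ofNat (r + 1) n)
  have hy {n : ℕ} (hn : n < r + 1) : y n = x ⟨n, hn⟩ :=
    congrArg x (Fin.ext (Nat.mod_eq_of_lt hn))
  have hlast : Function.update (fun l : Fin (r + 1) => y l) (Fin.last r) (x (Fin.last r))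
      = fun l : Fin (r + 1) => y l := by
    rw [Function.update_eq_self_iff]
    exact (hy (Nat.lt_succ_self r)).symm
  have key := eq_sum_setIntegral_simplexMap_add_remainder hf y (x (Fin.last r)) r
  rw [hlast, ← Finset.sum_range_succ (fun i => ∫ t in simplexSet i, iteratedFDeriv ℝ i f
    (simplexMap (fun l : Fin (i + 1) => y l) t) (fun l => x (Fin.last r) - y l)) r,
    Finset.sum_range] at key
  rw [key]
  refine Finset.sum_congr rfl fun i _ => ?_
  have hpts : (fun l : Fin ((i : ℕ) + 1) => y l) = x ∘ Fin.castLE i.isLt :=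
    funext fun l => hy (lt_of_lt_of_le l.isLt i.isLt)
  have hdirs : (fun l : Fin (i : ℕ) => x (Fin.last r) - y l)
      = fun l => x (Fin.last r) - x (Fin.castLE (le_of_lt i.isLt) l) :=
    funext fun l => congrArg _ (hy (l.isLt.trans i.isLt))
  rw [hpts, hdirs]
end
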